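/- At least one of the two real numbers Γ^(1)(1) and Γ^(2)(1) is transcendental. -/

import Mathlib

section

open Polynomial Filter Topology

theorem Real.contDiffAt_Gamma_of_pos {n : WithTop ℕ∞} {x : ℝ} (hx : 0 < x) :
    ContDiffAt ℝ n Real.Gamma x := by
  have hd : DifferentiableOn ℂ Complex.Gamma {s : ℂ | 0 < s.re} := fun s hs ↦
    (Complex.differentiableAt_Gamma s fun m h ↦ by
      have hs' : 0 < s.re := hs
      rw [h] at hs'
      simp only [Complex.neg_re, Complex.natCast_re] at hs'
      linarith [(Nat.cast_nonneg m : (0 : ℝ) ≤ m)]).differentiableWithinAt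
  have ho : IsOpen {s : ℂ | 0 < s.re} := isOpen_lt continuous_const Complex.continuous_re
  exact ((hd.analyticAt (ho.mem_nhds (x := (x : ℂ)) (by simpa using hx))).contDiffAt).real_of_complex

/-- The reflection formula in the form `Γ(1 + s) Γ(1 - s) sin(π s) = π s`, free of the poles
at `s = 0`. -/
theorem Real.Gamma_one_add_mul_Gamma_one_sub_mul_sin {s : ℝ} (hs : |s| < 1) :
    Real.Gamma (1 + s) * Real.Gamma (1 - s) * Real.sin (Real.pi * s) = Real.pi * s := by
  rcases eq_or_ne s 0 with rfl | h0
  · simp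
  have hsin : Real.sin (Real.pi * s) ≠ 0 := by
    rw [abs_lt] at hs
    intro h
    have := (Real.sin_eq_zero_iff_of_lt_of_lt (x := Real.pi * s)
      (by nlinarith [Real.pi_pos]) (by nlinarith [Real.pi_pos])).1 h
    simp [Real.pi_ne_zero, h0] at this
  rw [add_comm, Real.Gamma_add_one h0, mul_assoc s, Real.Gamma_mul_Gamma_one_sub, mul_assoc,
    div_mul_cancel₀ _ hsin, mul_comm]

/-- `Γ''(1) - Γ'(1)² = π² / 6`. -/
theorem Real.iteratedDeriv_two_Gamma_one_sub_sq :
    iteratedDeriv 2 Real.Gamma 1 - iteratedDeriv 1 Real.Gamma 1 ^ 2 = Real.pi ^ 2 / 6 := by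
  have hp (n : ℕ) : ContDiffAt ℝ n (fun s : ℝ ↦ Real.Gamma (1 + s)) 0 :=
    ContDiffAt.comp (g := Real.Gamma) (f := fun s : ℝ ↦ 1 + s) 0
      (Real.contDiffAt_Gamma_of_pos (by norm_num)) (by fun_prop)
  have hm (n : ℕ) : ContDiffAt ℝ n (fun s : ℝ ↦ Real.Gamma (1 - s)) 0 :=
    ContDiffAt.comp (g := Real.Gamma) (f := fun s : ℝ ↦ 1 - s) 0
      (Real.contDiffAt_Gamma_of_pos (by norm_num)) (by fun_prop)
  have hpi (i : ℕ) : iteratedDeriv i (fun s : ℝ ↦ Real.Gamma (1 + s)) 0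
      = iteratedDeriv i Real.Gamma 1 := by
    simp [iteratedDeriv_comp_const_add]
  have hmi (i : ℕ) : iteratedDeriv i (fun s : ℝ ↦ Real.Gamma (1 - s)) 0
      = (-1) ^ i * iteratedDeriv i Real.Gamma 1 := by
    have := iteratedDeriv_comp_neg i (fun s : ℝ ↦ Real.Gamma (1 + s)) 0
    simpa [hpi, sub_eq_add_neg] using this
  have hev : (fun s : ℝ ↦ Real.Gamma (1 + s) * Real.Gamma (1 - s) * Real.sin (Real.pi * s))
      =ᶠ[𝓝 0] fun s ↦ Real.pi * s := by
    filter_upwards [Metric.ball_mem_nhds (0 : ℝ) one_pos] with s hs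
    exact Real.Gamma_one_add_mul_Gamma_one_sub_mul_sin (by simpa using hs)
  have hsin (i : ℕ) : iteratedDeriv i (fun s : ℝ ↦ Real.sin (Real.pi * s)) 0
      = Real.pi ^ i * iteratedDeriv i Real.sin 0 := by
    rw [iteratedDeriv_comp_const_mul Real.contDiff_sin]; simp
  have h3 := hev.iteratedDeriv_eq 3
  rw [iteratedDeriv_fun_mul ((hp 3).mul (hm 3)) (by fun_prop)] at h3
  have hlin : iteratedDeriv 3 (fun s : ℝ ↦ Real.pi * s) 0 = 0 := by
    simp [iteratedDeriv_succ]
  have hprod (i : ℕ) := iteratedDeriv_fun_mul (hp i) (hm i)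
  have hs2 : iteratedDeriv 2 Real.sin 0 = 0 := by simp [iteratedDeriv_succ]
  have hs3 : iteratedDeriv 3 Real.sin 0 = -1 := by simp [iteratedDeriv_succ]
  have hs1 : iteratedDeriv 1 Real.sin 0 = 1 := by simp
  rw [hlin] at h3
  simp only [hprod, hpi, hmi, hsin, Finset.sum_range_succ, Finset.sum_range_zero, hs1,
    hs2, hs3] at h3
  simp [-iteratedDeriv_one] at h3
  refine mul_left_cancel₀ Real.pi_ne_zero ?_
  linarith

theorem IsIntegral.algebraMap_pow_mul_aeval {R A : Type*} [CommRing R] [CommRing A] [Algebra R A] {a : R}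
    {x : A} (h : IsIntegral R (a • x)) {g : R[X]} {N : ℕ} (hg : g.natDegree ≤ N) :
    IsIntegral R (algebraMap R A a ^ N * aeval x g) := by
  rw [aeval_eq_sum_range' (Nat.lt_succ_of_le hg), Finset.mul_sum]
  refine IsIntegral.sum _ fun i hi ↦ ?_
  have hi' : i ≤ N := Nat.lt_succ_iff.1 (Finset.mem_range.1 hi)
  have : algebraMap R A a ^ N * g.coeff i • x ^ i =
      algebraMap R A (a ^ (N - i) * g.coeff i) * (a • x) ^ i := by
    rw [← Nat.sub_add_cancel hi', pow_add, Nat.sub_add_cancel hi', Algebra.smul_def,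
      Algebra.smul_def, map_mul, map_pow, mul_pow]
    ring
  rw [this]
  exact isIntegral_algebraMap.mul (h.pow i)

theorem exists_intPolynomial_aeval_eq_zero {ι : Type*} (s : Finset ι) (b : ι → ℂ)
    (hb : ∀ i ∈ s, b i ≠ 0) (hb' : ∀ i ∈ s, IsAlgebraic ℤ (b i)) :
    ∃ f : ℤ[X], f.eval 0 ≠ 0 ∧ ∀ i ∈ s, aeval (b i) f = 0 := by
  have h (i : ι) : ∃ f : ℤ[X], f.coeff 0 ≠ 0 ∧ (i ∈ s → aeval (b i) f = 0) := by
    by_cases hi : i ∈ s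
    · obtain ⟨f, hf, hf'⟩ := (hb' i hi).exists_nonzero_coeff_and_aeval_eq_zero
        (mem_nonZeroDivisors_of_ne_zero (hb i hi))
      exact ⟨f, hf, fun _ ↦ hf'⟩
    · exact ⟨1, by simp, fun h ↦ absurd h hi⟩
  choose f hf hf' using h
  refine ⟨∏ i ∈ s, f i, ?_, fun i hi ↦ ?_⟩
  · rw [eval_prod, Finset.prod_ne_zero_iff]
    exact fun i _ ↦ by rw [← coeff_zero_eq_eval_zero]; exact hf i
  · rw [map_prod]
    exact Finset.prod_eq_zero hi (hf' i hi)

/-- If the power sums of nonzero algebraic numbers `b i` are rational, then `∑ exp (b i)` is not a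
negative integer. -/
theorem natCast_add_sum_exp_ne_zero {ι : Type*} (s : Finset ι) (b : ι → ℂ)
    (hb : ∀ i ∈ s, b i ≠ 0) (hb' : ∀ i ∈ s, IsAlgebraic ℤ (b i))
    (hsum : ∀ g : ℤ[X], ∃ q : ℚ, ∑ i ∈ s, aeval (b i) g = q) {k : ℕ} (hk : k ≠ 0) :
    (k : ℂ) + ∑ i ∈ s, Complex.exp (b i) ≠ 0 := by
  intro h0
  obtain ⟨f, hf0, hf⟩ := exists_intPolynomial_aeval_eq_zero s b hb hb'
  have hfne : f ≠ 0 := by rintro rfl; simp at hf0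
  obtain ⟨c, hc⟩ := LindemannWeierstrass.exp_polynomial_approx f hf0
  set a := f.leadingCoeff
  have ha0 : a ≠ 0 := leadingCoeff_ne_zero.2 hfne
  obtain ⟨N₀, hN₀⟩ := eventually_atTop.1 <|
    (FloorSemiring.tendsto_mul_pow_div_factorial_sub_atTop (s.card : ℝ)
      (|(a : ℝ)| ^ f.natDegree * c) 1).eventually (gt_mem_nhds zero_lt_one)
  obtain ⟨p, hp, hpp⟩ := Nat.exists_infinite_primes
    (N₀ + (eval 0 f).natAbs + a.natAbs + k + 1)
  obtain ⟨n, hn, g, hg, hgr⟩ := hc p (by lia) hpp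
  have hsmall := hN₀ p (by lia)
  set N := f.natDegree * p with hN
  have hint : IsIntegral ℤ ((a : ℂ) ^ N * ∑ i ∈ s, aeval (b i) g) := by
    rw [Finset.mul_sum]
    refine IsIntegral.sum _ fun i hi ↦ ?_
    have := (isIntegral_leadingCoeff_smul f (b i) (hf i hi)).algebraMap_pow_mul_aeval
      (g := g) (N := N) (by rw [hN, mul_comm]; lia)
    simpa using this
  obtain ⟨q, hq⟩ := hsum g
  obtain ⟨z, hz⟩ := hint.exists_int_iff_exists_rat.1 ⟨a ^ N * q, by rw [hq]; push_cast; rfl⟩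
  have hbound : ‖((a ^ N * (n * k) + p * z : ℤ) : ℂ)‖ < 1 := by
    have heq : ((a ^ N * (n * k) + p * z : ℤ) : ℂ) =
        -((a : ℂ) ^ N * ∑ i ∈ s, (n • Complex.exp (b i) - p • aeval (b i) g)) := by
      push_cast
      rw [← hz, Finset.sum_sub_distrib, ← Finset.smul_sum, ← Finset.smul_sum,
        eq_neg_of_add_eq_zero_right h0]
      simp only [zsmul_eq_mul, nsmul_eq_mul]
      ring
    rw [heq, norm_neg, norm_mul, norm_pow, Complex.norm_intCast]
    refine lt_of_le_of_lt ?_ hsmall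
    have : ‖∑ i ∈ s, (n • Complex.exp (b i) - p • aeval (b i) g)‖ ≤
        s.card * (c ^ p / (p - 1).factorial) := by
      rw [← nsmul_eq_mul]
      exact norm_sum_le_of_le _ (fun i hi ↦ hgr (mem_aroots.2 ⟨hfne, hf i hi⟩)) |>.trans_eq
        (by simp)
    grw [this]
    rw [mul_pow, ← pow_mul, ← hN]
    exact le_of_eq (by ring)
  rw [Complex.norm_intCast] at hbound
  have hzero : a ^ N * (n * k) + p * z = 0 := Int.abs_lt_one_iff.1 (by exact_mod_cast hbound)
  have hdvd : (p : ℤ) ∣ a ^ N * (n * k) :=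
    (Int.dvd_add_left (dvd_mul_right _ z)).1 (by simp [hzero])
  have hpZ : Prime (p : ℤ) := Nat.prime_iff_prime_int.1 hpp
  rcases hpZ.dvd_or_dvd hdvd with h | h
  · have := Nat.le_of_dvd (Int.natAbs_pos.2 ha0) (Int.natCast_dvd.1 (hpZ.dvd_of_dvd_pow h))
    lia
  · rcases hpZ.dvd_or_dvd h with h | h
    · exact hn h
    · have := Nat.le_of_dvd (Nat.pos_of_ne_zero hk) (Int.natCast_dvd_natCast.1 h)
      lia

/-- A special case of the Hermite–Lindemann theorem. -/
theorem exp_ne_neg_one_of_isAlgebraic {α : ℂ} (hα : IsAlgebraic ℚ α) : Complex.exp α ≠ -1 := by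
  classical
  intro hexp
  have hp0 : minpoly ℚ α ≠ 0 := minpoly.ne_zero hα.isIntegral
  let K := IntermediateField.adjoin ℚ ((minpoly ℚ α).rootSet ℂ)
  have : IsSplittingField ℚ K (minpoly ℚ α) :=
    IntermediateField.adjoin_rootSet_isSplittingField (IsAlgClosed.splits _)
  have : FiniteDimensional ℚ K := IsSplittingField.finiteDimensional K (minpoly ℚ α)
  have : IsGalois ℚ K :=
    IsGalois.of_separable_splitting_field (minpoly.irreducible hα.isIntegral).separable
  let x : K := ⟨α, IntermediateField.subset_adjoin ℚ _
    (mem_rootSet.2 ⟨hp0, minpoly.aeval ℚ α⟩)⟩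
  let b (S : Finset Gal(K/ℚ)) : K := ∑ σ ∈ S, σ x
  have hperm (τ : Gal(K/ℚ)) (S : Finset Gal(K/ℚ)) :
      b (S.map (Equiv.mulLeft τ).toEmbedding) = τ (b S) := by
    simp [b, Finset.sum_map, map_sum]
  have hprod : ∏ σ : Gal(K/ℚ), (1 + Complex.exp (σ x : K)) = 0 := by
    refine Finset.prod_eq_zero (Finset.mem_univ 1) ?_
    simp [x, hexp]
  have hsum : ∑ S : Finset Gal(K/ℚ), Complex.exp (b S) = 0 := by
    rw [← hprod, Finset.prod_one_add, Finset.powerset_univ]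
    refine Finset.sum_congr rfl fun S _ ↦ ?_
    rw [← Complex.exp_sum]
    simp [b]
  rw [← Finset.sum_filter_add_sum_filter_not _ (fun S ↦ b S = 0)] at hsum
  refine natCast_add_sum_exp_ne_zero (Finset.univ.filter fun S ↦ ¬ b S = 0)
    (fun S ↦ (b S : ℂ)) ?_ ?_ ?_ (k := (Finset.univ.filter fun S ↦ b S = 0).card) ?_ ?_
  · intro S hS
    simpa using hS
  · intro S _
    exact (IsFractionRing.isAlgebraic_iff ℤ ℚ ℂ).2
      ((Algebra.IsAlgebraic.isAlgebraic (R := ℚ) (b S)).algebraMap (A := ℂ))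
  · intro g
    have hfix : ∑ S with ¬ b S = 0, aeval (b S) g ∈ Set.range (algebraMap ℚ K) := by
      rw [IsGalois.mem_range_algebraMap_iff_fixed]
      intro τ
      rw [map_sum]
      refine Finset.sum_equiv (Equiv.finsetCongr (Equiv.mulLeft τ)) ?_ ?_
      · intro S
        simp [Equiv.finsetCongr_apply, hperm]
      · intro S _
        rw [Equiv.finsetCongr_apply, hperm]
        exact (aeval_algHom_apply (τ.toAlgHom.restrictScalars ℤ) (b S) g).symm
    obtain ⟨q, hq⟩ := hfix
    refine ⟨q, ?_⟩
    have := congrArg (algebraMap K ℂ) hq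
    rw [map_sum, ← IsScalarTower.algebraMap_apply] at this
    simpa [← aeval_algebraMap_apply] using this.symm
  · exact Finset.card_ne_zero_of_mem (a := ∅) (by simp [b])
  · rw [← hsum]
    congr 1
    rw [Finset.sum_congr rfl (g := fun _ ↦ (1 : ℂ)) (by
      intro S hS
      simp [(Finset.mem_filter.1 hS).2])]
    simp

/-- **Lindemann's theorem**: `π` is transcendental. -/
theorem Real.transcendental_pi : Transcendental ℚ Real.pi := by
  intro h
  have hI : IsAlgebraic ℚ Complex.I := by
    refine ⟨X ^ 2 + 1, (by monicity! : (X ^ 2 + 1 : ℚ[X]).Monic).ne_zero, by simp⟩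
  exact exp_ne_neg_one_of_isAlgebraic ((h.algebraMap (A := ℂ)).mul hI) Complex.exp_pi_mul_I

end

/-- At least one of `Γ'(1)` and `Γ''(1)` is transcendental. -/
theorem transcendental_gamma_first_or_second_deriv_one :
    Transcendental ℚ (iteratedDeriv 1 Real.Gamma 1) ∨
    Transcendental ℚ (iteratedDeriv 2 Real.Gamma 1) := by
  by_contra! h
  simp only [Transcendental, not_not] at h
  refine Real.transcendental_pi (IsAlgebraic.of_pow two_pos ?_)
  have hpi : Real.pi ^ 2 =
      algebraMap ℚ ℝ 6 * (iteratedDeriv 2 Real.Gamma 1 - iteratedDeriv 1 Real.Gamma 1 ^ 2) := by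
    rw [Real.iteratedDeriv_two_Gamma_one_sub_sq, map_ofNat]
    ring
  rw [hpi]
  exact (isAlgebraic_algebraMap 6).mul (h.2.sub (h.1.pow 2))
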